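/- arXiv:2103.16073 — 2 statements merged into one kernel-verified Lean document; each statement's English description precedes it below -/
import Mathlib

section
/- Let k be a real number and let r_s be a point of ℝ³. The free-space Green's function of the Helmholtz equation, ψ(r) = exp(i k |r − r_s|) / (4π |r − r_s|), is a complex-valued function on ℝ³ \ {r_s} that satisfies the Helmholtz equation Δψ(r) + k²ψ(r) = 0 at every point r ≠ r_s. -/
/-- The Laplacian of a function on ℝ³: the sum of the second partial
derivatives with respect to the three coordinates. -/
noncomputable def laplacian {F : Type*} [NormedAddCommGroup F] [NormedSpace ℝ F]
    (f : EuclideanSpace ℝ (Fin 3) → F) (r : EuclideanSpace ℝ (Fin 3)) : F :=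
  ∑ i : Fin 3,
    fderiv ℝ (fun x => fderiv ℝ f x (EuclideanSpace.single i (1 : ℝ))) r
      (EuclideanSpace.single i (1 : ℝ))

/-- The derivative of the distance to a fixed point, away from that point. -/
theorem hasFDerivAt_dist_left {E : Type*} [NormedAddCommGroup E] [InnerProductSpace ℝ E]
    {s x : E} (hx : x ≠ s) :
    HasFDerivAt (fun y => dist y s) ((dist x s)⁻¹ • innerSL ℝ (x - s)) x := by
  have hd : dist x s ≠ 0 := dist_ne_zero.mpr hx
  have hsq : HasFDerivAt (fun y => ‖y - s‖ ^ 2) _ x :=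
    ((hasFDerivAt_id x).sub_const s).norm_sq
  have hsqrt := hsq.sqrt (by rw [← dist_eq_norm]; positivity)
  simp only [← dist_eq_norm, Real.sqrt_sq dist_nonneg] at hsqrt
  refine hsqrt.congr_fderiv ?_
  ext v
  simp
  field_simp

/-- The Laplacian of a radial function on ℝ³, away from its centre. -/
theorem laplacian_comp_dist {F : Type*} [NormedAddCommGroup F] [NormedSpace ℝ F]
    {g g' g'' : ℝ → F} (hg : ∀ t, 0 < t → HasDerivAt g (g' t) t)
    (hg' : ∀ t, 0 < t → HasDerivAt g' (g'' t) t)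
    {s r : EuclideanSpace ℝ (Fin 3)} (hr : r ≠ s) :
    laplacian (fun x => g (dist x s)) r
      = g'' (dist r s) + (2 / dist r s) • g' (dist r s) := by
  have hd : 0 < dist r s := dist_pos.mpr hr
  have hfderiv (x : EuclideanSpace ℝ (Fin 3)) (hx : x ≠ s) (i : Fin 3) :
      fderiv ℝ (fun y => g (dist y s)) x (EuclideanSpace.single i (1 : ℝ))
        = (x i - s i) • (dist x s)⁻¹ • g' (dist x s) := by
    have h := (hg _ (dist_pos.mpr hx)).hasFDerivAt.comp x (hasFDerivAt_dist_left hx)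
    rw [show (fun y => g (dist y s)) = g ∘ fun y => dist y s from rfl, h.fderiv]
    simp [EuclideanSpace.inner_single_right]
    module
  have hsecond (i : Fin 3) :
      fderiv ℝ (fun x => fderiv ℝ (fun y => g (dist y s)) x
          (EuclideanSpace.single i (1 : ℝ))) r (EuclideanSpace.single i (1 : ℝ))
        = (dist r s)⁻¹ • g' (dist r s) + ((r i - s i) ^ 2 / dist r s) •
          ((dist r s)⁻¹ • g'' (dist r s) - (dist r s ^ 2)⁻¹ • g' (dist r s)) := by
    have hev : (fun x => fderiv ℝ (fun y => g (dist y s)) x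
        (EuclideanSpace.single i (1 : ℝ))) =ᶠ[nhds r]
        fun x => (x i - s i) • (dist x s)⁻¹ • g' (dist x s) := by
      filter_upwards [isOpen_ne.mem_nhds hr] with x hx using hfderiv x hx i
    have hcoord : HasFDerivAt (fun x : EuclideanSpace ℝ (Fin 3) => x i - s i)
        (EuclideanSpace.proj i : EuclideanSpace ℝ (Fin 3) →L[ℝ] ℝ) r :=
      (EuclideanSpace.proj i : EuclideanSpace ℝ (Fin 3) →L[ℝ] ℝ).hasFDerivAt.sub_const _
    have hrad := ((hasDerivAt_inv hd.ne').smul (hg' _ hd)).hasFDerivAt.comp r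
      (hasFDerivAt_dist_left hr)
    rw [hev.fderiv_eq]
    refine (congrArg (· (EuclideanSpace.single i (1 : ℝ))) (hcoord.smul hrad).fderiv).trans ?_
    simp [EuclideanSpace.inner_single_right]
    module
  have hnorm : ∑ i, (r i - s i) ^ 2 = dist r s ^ 2 := by
    rw [EuclideanSpace.dist_eq, Real.sq_sqrt (by positivity)]
    simp [Real.dist_eq]
  simp only [laplacian, hsecond, Finset.sum_add_distrib, ← Finset.sum_smul, ← Finset.sum_div,
    hnorm, Finset.sum_const, Finset.card_univ, Fintype.card_fin]
  match_scalars
  · simp only [nsmul_eq_mul]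
    field_simp
    norm_num
  · field_simp

/-- The derivative of `t ↦ exp (c t)` along the real axis. -/
theorem hasDerivAt_cexp_mul_ofReal (c : ℂ) (t : ℝ) :
    HasDerivAt (fun t : ℝ => Complex.exp (c * t)) (c * Complex.exp (c * t)) t := by
  simpa [mul_comm] using ((Complex.ofRealCLM.hasDerivAt (x := t)).const_mul c).cexp

/-- The free-space Green's function of the Helmholtz equation,
`ψ(r) = exp(i k |r − r_s|) / (4π |r − r_s|)`, satisfies the Helmholtz equation
`Δψ + k²ψ = 0` at every point `r ≠ r_s`. -/
theorem greens_function_satisfies_helmholtz (k : ℝ) (r_s : EuclideanSpace ℝ (Fin 3))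
    (ψ : EuclideanSpace ℝ (Fin 3) → ℂ)
    (hψ : ∀ r, ψ r = Complex.exp (Complex.I * k * (dist r r_s : ℝ)) /
      (4 * (Real.pi : ℂ) * (dist r r_s : ℝ))) :
    ∀ r : EuclideanSpace ℝ (Fin 3), r ≠ r_s →
      laplacian ψ r + (k : ℂ) ^ 2 * ψ r = 0 := by
  intro r hr
  set c : ℂ := Complex.I * k with hc
  have hpi : (Real.pi : ℂ) ≠ 0 := Complex.ofReal_ne_zero.mpr Real.pi_ne_zero
  have hcast (t : ℝ) : HasDerivAt (fun t : ℝ => (t : ℂ)) 1 t :=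
    Complex.ofRealCLM.hasDerivAt
  have hg (t : ℝ) (ht : 0 < t) :
      HasDerivAt (fun t : ℝ => Complex.exp (c * t) / (4 * (Real.pi : ℂ) * t))
        ((c * t - 1) * Complex.exp (c * t) / (4 * Real.pi * t ^ 2)) t := by
    have ht' : (t : ℂ) ≠ 0 := Complex.ofReal_ne_zero.mpr ht.ne'
    refine ((hasDerivAt_cexp_mul_ofReal c t).div
      ((hcast t).const_mul (4 * (Real.pi : ℂ))) (by simp [hpi, ht'])).congr_deriv ?_
    field_simp
  have hg' (t : ℝ) (ht : 0 < t) :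
      HasDerivAt (fun t : ℝ => (c * t - 1) * Complex.exp (c * t) / (4 * (Real.pi : ℂ) * t ^ 2))
        ((c ^ 2 * t ^ 2 - 2 * c * t + 2) * Complex.exp (c * t) / (4 * Real.pi * t ^ 3)) t := by
    have ht' : (t : ℂ) ≠ 0 := Complex.ofReal_ne_zero.mpr ht.ne'
    refine (((((hcast t).const_mul c).sub_const 1).mul (hasDerivAt_cexp_mul_ofReal c t)).div
      (((hcast t).pow 2).const_mul (4 * (Real.pi : ℂ))) (by simp [hpi, ht'])).congr_deriv ?_
    simp
    field_simp
    ring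
  have hd : ((dist r r_s : ℝ) : ℂ) ≠ 0 := Complex.ofReal_ne_zero.mpr (dist_ne_zero.mpr hr)
  have hc2 : (k : ℂ) ^ 2 = -c ^ 2 := by rw [hc, mul_pow, Complex.I_sq]; ring
  rw [funext hψ, laplacian_comp_dist hg hg' hr, hc2, Complex.real_smul]
  push_cast
  field_simp
  ring
end

section
/- Let k be a real number, r' a point of ℝ³, and v a vector of ℝ³. Define the dipole field ψ(r) = d/dε at ε = 0 of [exp(i k |r − (r' + εv)|) / (4π |r − (r' + εv)|)], i.e. the directional derivative in the source point r' along v of the free-space Helmholtz Green's function G_k(r, r') = exp(i k |r − r'|)/(4π |r − r'|). Then ψ satisfies the Helmholtz equation Δψ(r) + k²ψ(r) = 0 at every point r ≠ r'. -/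
/-- The free-space Helmholtz Green's function `G_k(r, r')`. -/
noncomputable def greenFn (k : ℝ) (r r' : EuclideanSpace ℝ (Fin 3)) : ℂ :=
  Complex.exp (Complex.I * k * (dist r r' : ℝ)) / (4 * (Real.pi : ℂ) * (dist r r' : ℝ))

/-- The gradient of a radial function `x ↦ F ‖x - c‖` is `F' (‖x - c‖) / ‖x - c‖ • (x - c)`. -/
theorem hasFDerivAt_radial {E : Type*} [NormedAddCommGroup E] [InnerProductSpace ℝ E]
    {F : ℝ → ℂ} {F' : ℂ} {x c : E} (hx : x ≠ c)
    (hF : HasDerivAt F ((‖x - c‖ : ℂ) * F') ‖x - c‖) :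
    HasFDerivAt (fun y => F ‖y - c‖) ((innerSL ℝ (x - c)).smulRight F') x := by
  have hne : ‖x - c‖ ≠ 0 := norm_ne_zero_iff.mpr (sub_ne_zero.mpr hx)
  have hsq : HasFDerivAt (fun y => ‖y - c‖ ^ 2) _ x := ((hasFDerivAt_id x).sub_const c).norm_sq
  have hnorm := hsq.sqrt (pow_ne_zero 2 hne)
  simp only [Real.sqrt_sq (norm_nonneg _)] at hnorm
  refine (HasFDerivAt.comp x hF.hasFDerivAt hnorm).congr_fderiv ?_
  ext w
  have hne' : (‖x - c‖ : ℂ) ≠ 0 := by exact_mod_cast hne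
  simp
  field_simp

/-- The outgoing wave `exp (i k R) / (4 π)` as a function of the radius `R`. -/
noncomputable def outgoingWave (k R : ℝ) : ℂ :=
  Complex.exp (Complex.I * k * R) / (4 * (Real.pi : ℂ))

theorem hasDerivAt_outgoingWave (k R : ℝ) :
    HasDerivAt (outgoingWave k) (Complex.I * k * outgoingWave k R) R := by
  have h := (((hasDerivAt_id R).ofReal_comp.const_mul (Complex.I * k)).cexp).div_const
    (4 * (Real.pi : ℂ))
  refine h.congr_deriv ?_
  simp only [outgoingWave, id]
  push_cast
  ring

theorem hasDerivAt_ofReal_inv_pow {R : ℝ} (hR : R ≠ 0) (n : ℕ) :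
    HasDerivAt (fun t : ℝ => ((t : ℂ)⁻¹) ^ n) (-n * ((R : ℂ)⁻¹) ^ (n + 1)) R := by
  have hR' : (R : ℂ) ≠ 0 := by exact_mod_cast hR
  refine (((hasDerivAt_id R).ofReal_comp.inv hR').pow n).congr_deriv ?_
  rcases n with _ | n
  · simp
  · simp only [id, Nat.add_sub_cancel, Pi.inv_apply]
    push_cast
    ring

/-- The radial Green's function. -/
noncomputable def greenRadial (k R : ℝ) : ℂ :=
  outgoingWave k R * (R : ℂ)⁻¹ ^ 1

/-- The operator `R⁻¹ d/dR` applied once to `greenRadial`. -/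
noncomputable def greenRadialOne (k R : ℝ) : ℂ :=
  outgoingWave k R * (Complex.I * k * (R : ℂ)⁻¹ ^ 2 - (R : ℂ)⁻¹ ^ 3)

/-- The operator `R⁻¹ d/dR` applied twice to `greenRadial`. -/
noncomputable def greenRadialTwo (k R : ℝ) : ℂ :=
  outgoingWave k R * ((Complex.I * k) ^ 2 * (R : ℂ)⁻¹ ^ 3 - 3 * (Complex.I * k) * (R : ℂ)⁻¹ ^ 4
    + 3 * (R : ℂ)⁻¹ ^ 5)

/-- The operator `R⁻¹ d/dR` applied three times to `greenRadial`. -/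
noncomputable def greenRadialThree (k R : ℝ) : ℂ :=
  outgoingWave k R * ((Complex.I * k) ^ 3 * (R : ℂ)⁻¹ ^ 4 - 6 * (Complex.I * k) ^ 2 * (R : ℂ)⁻¹ ^ 5
    + 15 * (Complex.I * k) * (R : ℂ)⁻¹ ^ 6 - 15 * (R : ℂ)⁻¹ ^ 7)

theorem hasDerivAt_greenRadial (k : ℝ) {R : ℝ} (hR : R ≠ 0) :
    HasDerivAt (greenRadial k) (R * greenRadialOne k R) R := by
  have hR' : (R : ℂ) ≠ 0 := by exact_mod_cast hR
  refine ((hasDerivAt_outgoingWave k R).mul (hasDerivAt_ofReal_inv_pow hR 1)).congr_deriv ?_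
  simp only [greenRadialOne]
  push_cast
  field_simp
  ring

theorem hasDerivAt_greenRadialOne (k : ℝ) {R : ℝ} (hR : R ≠ 0) :
    HasDerivAt (greenRadialOne k) (R * greenRadialTwo k R) R := by
  have hR' : (R : ℂ) ≠ 0 := by exact_mod_cast hR
  refine ((hasDerivAt_outgoingWave k R).mul
    (((hasDerivAt_ofReal_inv_pow hR 2).const_mul (Complex.I * k)).sub
      (hasDerivAt_ofReal_inv_pow hR 3))).congr_deriv ?_
  simp only [greenRadialTwo, Pi.sub_apply]
  push_cast
  field_simp
  ring

theorem hasDerivAt_greenRadialTwo (k : ℝ) {R : ℝ} (hR : R ≠ 0) :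
    HasDerivAt (greenRadialTwo k) (R * greenRadialThree k R) R := by
  have hR' : (R : ℂ) ≠ 0 := by exact_mod_cast hR
  refine ((hasDerivAt_outgoingWave k R).mul
    ((((hasDerivAt_ofReal_inv_pow hR 3).const_mul ((Complex.I * k) ^ 2)).sub
      ((hasDerivAt_ofReal_inv_pow hR 4).const_mul (3 * (Complex.I * k)))).add
      ((hasDerivAt_ofReal_inv_pow hR 5).const_mul 3))).congr_deriv ?_
  simp only [greenRadialThree, Pi.sub_apply, Pi.add_apply]
  push_cast
  field_simp
  ring

/-- The radial form of the Helmholtz equation for a dipole field. -/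
theorem greenRadial_helmholtz (k : ℝ) {R : ℝ} (hR : R ≠ 0) :
    (R : ℂ) ^ 2 * greenRadialThree k R + 5 * greenRadialTwo k R
      + (k : ℂ) ^ 2 * greenRadialOne k R = 0 := by
  have hR' : (R : ℂ) ≠ 0 := by exact_mod_cast hR
  simp only [greenRadialOne, greenRadialTwo, greenRadialThree]
  field_simp
  ring_nf
  simp only [Complex.I_sq, show Complex.I ^ 3 = -Complex.I from Complex.I_pow_three]
  ring

theorem greenFn_eq_greenRadial (k : ℝ) (r r' : EuclideanSpace ℝ (Fin 3)) :
    greenFn k r r' = greenRadial k ‖r - r'‖ := by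
  simp only [greenFn, greenRadial, outgoingWave, dist_eq_norm]
  rw [pow_one, ← div_eq_mul_inv, div_div]

theorem deriv_greenFn_source (k : ℝ) {r r' : EuclideanSpace ℝ (Fin 3)}
    (v : EuclideanSpace ℝ (Fin 3)) (hr : r ≠ r') :
    deriv (fun ε : ℝ => greenFn k r (r' + ε • v)) 0
      = -(greenRadialOne k ‖r - r'‖ * (inner ℝ (r - r') v : ℝ)) := by
  have hne : ‖r - r'‖ ≠ 0 := norm_ne_zero_iff.mpr (sub_ne_zero.mpr hr)
  have hline : HasDerivAt (fun ε : ℝ => r - ε • v) (-v) 0 := by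
    simpa using ((hasDerivAt_id (0 : ℝ)).smul_const v).const_sub r
  have hrad := hasFDerivAt_radial hr (hasDerivAt_greenRadial k hne)
  have h := HasFDerivAt.comp_hasDerivAt_of_eq (0 : ℝ) hrad hline (by simp)
  have hfun : (fun ε : ℝ => greenFn k r (r' + ε • v))
      = (fun y => greenRadial k ‖y - r'‖) ∘ fun ε : ℝ => r - ε • v := by
    funext ε
    rw [greenFn_eq_greenRadial, Function.comp_apply, ← sub_sub, sub_right_comm]
  rw [hfun, h.deriv]
  simp [-map_sub, mul_comm]

theorem hasFDerivAt_ofReal_inner_sub {E : Type*} [NormedAddCommGroup E] [InnerProductSpace ℝ E]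
    (c w x : E) :
    HasFDerivAt (fun y => ((inner ℝ (y - c) w : ℝ) : ℂ))
      (Complex.ofRealCLM.comp (innerSL ℝ w)) x := by
  have h := (Complex.ofRealCLM.comp (innerSL ℝ w)).hasFDerivAt.comp x
    ((hasFDerivAt_id x).sub_const c)
  refine (h.congr_fderiv (by ext; simp)).congr_of_eventuallyEq (.of_forall fun y => ?_)
  simp [real_inner_comm]

/-- The dipole field, the directional derivative in the source point `r'` along `v` of the
free-space Helmholtz Green's function, satisfies the Helmholtz equation
`Δψ + k²ψ = 0` at every point `r ≠ r'`. -/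
theorem dipole_field_satisfies_helmholtz (k : ℝ) (r' v : EuclideanSpace ℝ (Fin 3))
    (ψ : EuclideanSpace ℝ (Fin 3) → ℂ)
    (hψ : ∀ r, ψ r = deriv (fun ε : ℝ => greenFn k r (r' + ε • v)) 0) :
    ∀ r : EuclideanSpace ℝ (Fin 3), r ≠ r' →
      laplacian ψ r + (k : ℂ) ^ 2 * ψ r = 0 := by
  intro r hr
  have hnorm : ∀ {x}, x ≠ r' → ‖x - r'‖ ≠ 0 := fun hx =>
    norm_ne_zero_iff.mpr (sub_ne_zero.mpr hx)
  have hψ' : ∀ x, x ≠ r' →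
      ψ x = -(greenRadialOne k ‖x - r'‖ * (inner ℝ (x - r') v : ℝ)) := fun x hx => by
    rw [hψ, deriv_greenFn_source k v hx]
  have hev : ∀ {x}, x ≠ r' → ∀ᶠ y in nhds x, y ≠ r' := fun hx => isOpen_ne.mem_nhds hx
  have hfirst : ∀ w x, x ≠ r' → fderiv ℝ ψ x w =
      -(greenRadialTwo k ‖x - r'‖ * (inner ℝ (x - r') w : ℝ) * (inner ℝ (x - r') v : ℝ)
        + greenRadialOne k ‖x - r'‖ * (inner ℝ v w : ℝ)) := fun w x hx => by
    have h := ((hasFDerivAt_radial hx (hasDerivAt_greenRadialOne k (hnorm hx))).mul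
      (hasFDerivAt_ofReal_inner_sub r' v x)).neg
    rw [(h.congr_of_eventuallyEq ((hev hx).mono hψ')).fderiv]
    simp [-map_sub]
    ring
  have hsecond : ∀ w, fderiv ℝ (fun x => fderiv ℝ ψ x w) r w =
      -(greenRadialThree k ‖r - r'‖ * (inner ℝ (r - r') w : ℝ) ^ 2 * (inner ℝ (r - r') v : ℝ)
        + greenRadialTwo k ‖r - r'‖ * (inner ℝ w w : ℝ) * (inner ℝ (r - r') v : ℝ)
        + 2 * greenRadialTwo k ‖r - r'‖ * (inner ℝ (r - r') w : ℝ) * (inner ℝ v w : ℝ)) :=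
      fun w => by
    have h := ((((hasFDerivAt_radial hr (hasDerivAt_greenRadialTwo k (hnorm hr))).mul
      (hasFDerivAt_ofReal_inner_sub r' w r)).mul (hasFDerivAt_ofReal_inner_sub r' v r)).add
      ((hasFDerivAt_radial hr (hasDerivAt_greenRadialOne k (hnorm hr))).mul_const
        ((inner ℝ v w : ℝ) : ℂ))).neg
    rw [(h.congr_of_eventuallyEq ((hev hr).mono (hfirst w))).fderiv]
    simp [-map_sub, -inner_self_eq_norm_sq_to_K]
    ring
  have hsq : ((‖r - r'‖ : ℝ) : ℂ) ^ 2 =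
      ((r - r') 0 : ℂ) ^ 2 + ((r - r') 1 : ℂ) ^ 2 + ((r - r') 2 : ℂ) ^ 2 := by
    have h := EuclideanSpace.real_norm_sq_eq (r - r')
    rw [Fin.sum_univ_three] at h
    exact_mod_cast h
  have hinner : ((inner ℝ (r - r') v : ℝ) : ℂ) =
      (r - r') 0 * v 0 + (r - r') 1 * v 1 + (r - r') 2 * v 2 := by
    rw [PiLp.inner_apply, Fin.sum_univ_three]
    simp
    ring
  have hrad := greenRadial_helmholtz k (hnorm hr)
  simp only [laplacian, hsecond, hψ' r hr, Fin.sum_univ_three,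
    EuclideanSpace.inner_single_right]
  generalize r - r' = d at *
  simp
  rw [hsq] at hrad
  rw [hinner]
  linear_combination (-(d 0 * v 0 + d 1 * v 1 + d 2 * v 2 : ℂ)) * hrad
end
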